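/- For every integer n ≥ 1 there exist a finite alphabet A and a constant-length, primitive, proper and recognizable directive sequence τ of alphabet rank at most max{2, n^n} such that X_τ ⊆ A^ℤ is an aperiodic Toeplitz subshift (hence a strong Toeplitz subshift of rank max{2, n^n}) whose automorphism group Aut(X_τ, S) is isomorphic as a group to ℤ × (ℤ/nℤ). -/

import Mathlib

namespace ToeplitzFR

open Set

variable {A B C : Type*}

/-- The shift map `S` on `ℤ → A`: `S(x)(i) = x(i+1)`. -/
def shift (x : ℤ → A) : ℤ → A := fun i => x (i + 1)

/-- The inverse shift map `S⁻¹`. -/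
def shiftInv (x : ℤ → A) : ℤ → A := fun i => x (i - 1)

/-- The shift by `k`: `S^k`. -/
def shiftBy (k : ℤ) (x : ℤ → A) : ℤ → A := fun i => x (i + k)

/-- The finite word `x[i, i+n)`. -/
def factorAt (x : ℤ → A) (i : ℤ) (n : ℕ) : List A :=
  (List.range n).map fun j => x (i + j)

/-- `x` is a periodic point of the shift. -/
def IsPeriodicPoint (x : ℤ → A) : Prop := ∃ p : ℕ, 0 < p ∧ ∀ i : ℤ, x (i + p) = x i

def IsAperiodicPoint (x : ℤ → A) : Prop := ¬ IsPeriodicPoint x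

/-- `Per_p(x)`. -/
def PerSet (x : ℤ → A) (p : ℕ) : Set ℤ := {i : ℤ | ∀ k : ℤ, x (i + k * p) = x i}

/-- `Per(x) = ⋃_{p>1} Per_p(x)`. -/
def PerAll (x : ℤ → A) : Set ℤ := {i : ℤ | ∃ p : ℕ, 1 < p ∧ i ∈ PerSet x p}

/-- `x` is a Toeplitz sequence. -/
def IsToeplitz (x : ℤ → A) : Prop := ∀ i : ℤ, ∃ p : ℕ, 1 < p ∧ i ∈ PerSet x p

/-- The shift orbit of `x`. -/
def orbit (x : ℤ → A) : Set (ℤ → A) := {y | ∃ k : ℤ, y = shiftBy k x}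

/-- `X` is the Toeplitz subshift generated by the Toeplitz sequence `x`. -/
def ToeplitzGenerates [TopologicalSpace A] (x : ℤ → A) (X : Set (ℤ → A)) : Prop :=
  IsToeplitz x ∧ X = closure (orbit x)

/-- `X` is a Toeplitz subshift. -/
def IsToeplitzSubshift [TopologicalSpace A] (X : Set (ℤ → A)) : Prop :=
  ∃ x : ℤ → A, ToeplitzGenerates x X

/-- The `p`-skeleton of `x`, with `none` as the blank symbol. -/
noncomputable def Skel (x : ℤ → A) (p : ℕ) : ℤ → Option A :=
  fun i => @ite _ (i ∈ PerSet x p) (Classical.dec _) (some (x i)) none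

/-- `p` is an essential period of `x`. -/
def IsEssentialPeriod (x : ℤ → A) (p : ℕ) : Prop :=
  1 < p ∧ ∀ q : ℕ, 0 < q → q < p → ∃ i : ℤ, Skel x p (i + q) ≠ Skel x p i

/-- `(P n)` is a period structure for `x`. -/
def IsPeriodStructure (x : ℤ → A) (P : ℕ → ℕ) : Prop :=
  StrictMono P ∧ (∀ n, IsEssentialPeriod x (P n)) ∧ (∀ n, P n ∣ P (n+1)) ∧
    ∀ i : ℤ, ∃ n, i ∈ PerSet x (P n)

/-- `q` divides the scale of the Toeplitz subshift `X`. -/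
def DividesScale [TopologicalSpace A] (X : Set (ℤ → A)) (q : ℕ) : Prop :=
  ∃ (x : ℤ → A) (P : ℕ → ℕ),
    ToeplitzGenerates x X ∧ IsPeriodStructure x P ∧ ∃ n, q ∣ P n

/-! ### Directive sequences and S-adic subshifts -/

/-- All morphisms in the directive sequence are non-erasing. -/
def NonErasing {A : ℕ → Type*} (τ : ∀ n, A (n+1) → List (A n)) : Prop :=
  ∀ n a, τ n a ≠ []

/-- The directive sequence has constant length. -/
def ConstantLength {A : ℕ → Type*} (τ : ∀ n, A (n+1) → List (A n)) : Prop :=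
  ∀ n, ∀ a b : A (n+1), (τ n a).length = (τ n b).length

/-- The directive sequence is proper. -/
def ProperSeq {A : ℕ → Type*} (τ : ∀ n, A (n+1) → List (A n)) : Prop :=
  ∀ n, ∃ b c : A n, ∀ a : A (n+1), (τ n a).head? = some b ∧ (τ n a).getLast? = some c

/-- `sadicWordAux τ n k a = τ_{[n, n+k)}(a)`. -/
def sadicWordAux {A : ℕ → Type*} (τ : ∀ n, A (n+1) → List (A n)) (n : ℕ) :
    ∀ k : ℕ, A (n + k) → List (A n)
  | 0, a => [a]
  | (k+1), a => (τ (n+k) a).flatMap (sadicWordAux τ n k)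

/-- `word0 τ k a = τ_{[0, k)}(a)` for `a ∈ A k`. -/
def word0 {A : ℕ → Type*} (τ : ∀ n, A (n+1) → List (A n)) :
    ∀ k : ℕ, A k → List (A 0)
  | 0, a => [a]
  | (k+1), a => (τ k a).flatMap (word0 τ k)

/-- The directive sequence is primitive. -/
def PrimitiveSeq {A : ℕ → Type*} (τ : ∀ n, A (n+1) → List (A n)) : Prop :=
  ∀ n, ∃ k : ℕ, 0 < k ∧ ∀ (a : A (n+k)) (b : A n), b ∈ sadicWordAux τ n k a

/-- The `n`-th level `X_τ^{(n)}` of the S-adic system generated by `τ`. -/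
def XLevel {A : ℕ → Type*} (τ : ∀ n, A (n+1) → List (A n)) (n : ℕ) :
    Set (ℤ → A n) :=
  {y | ∀ (i : ℤ) (m : ℕ), ∃ k : ℕ, 0 < k ∧ ∃ a : A (n+k),
      (factorAt y i m).IsInfix (sadicWordAux τ n k a)}

/-- The alphabet rank (`liminf_n |A_n|`) is at most `K`. -/
def AlphabetRankLE (A : ℕ → Type*) [∀ n, Fintype (A n)] (K : ℕ) : Prop :=
  ∀ N : ℕ, ∃ n, N ≤ n ∧ Fintype.card (A n) ≤ K

/-! ### Recognizability -/

/-- `z` is the bi-infinite concatenation `⋯σ(y(-1)).σ(y(0))σ(y(1))⋯`,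
with `σ(y(0))` starting at coordinate `0`. -/
def IsConcat (σ : B → List C) (y : ℤ → B) (z : ℤ → C) : Prop :=
  ∃ c : ℤ → ℤ, c 0 = 0 ∧ (∀ j : ℤ, c (j + 1) = c j + (σ (y j)).length) ∧
    ∀ (j : ℤ) (m : Fin (σ (y j)).length), z (c j + (m : ℕ)) = (σ (y j)).get m

/-- `(y, k)` is a centered `σ`-representation of `x` in `Y`. -/
def IsCenteredRep (σ : B → List C) (Y : Set (ℤ → B)) (x : ℤ → C)
    (y : ℤ → B) (k : ℕ) : Prop :=
  y ∈ Y ∧ k < (σ (y 0)).length ∧ IsConcat σ y (fun m => x (m - k))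

/-- The morphism `σ` is recognizable in `Y`. -/
def RecognizableIn (σ : B → List C) (Y : Set (ℤ → B)) : Prop :=
  ∀ (x : ℤ → C) (y y' : ℤ → B) (k k' : ℕ),
    IsCenteredRep σ Y x y k → IsCenteredRep σ Y x y' k' → y = y' ∧ k = k'

/-- The directive sequence `τ` is recognizable. -/
def RecognizableSeq {A : ℕ → Type*} (τ : ∀ n, A (n+1) → List (A n)) : Prop :=
  ∀ n, RecognizableIn (τ n) (XLevel τ (n+1))

/-! ### Conjugacy -/

/-- `(X, TX)` and `(Y, TY)` are conjugate via a homeomorphism. -/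
def ConjugateBy [TopologicalSpace A] [TopologicalSpace B]
    (X : Set (ℤ → A)) (Y : Set (ℤ → B))
    (TX : (ℤ → A) → (ℤ → A)) (TY : (ℤ → B) → (ℤ → B)) : Prop :=
  ∃ φ : ↥X ≃ₜ ↥Y, ∀ (x : ℤ → A) (hx : x ∈ X) (hx' : TX x ∈ X),
    (φ ⟨TX x, hx'⟩).1 = TY (φ ⟨x, hx⟩).1

/-- `(X, S)` and `(Y, S)` are conjugate subshifts. -/
def Conjugate [TopologicalSpace A] [TopologicalSpace B]
    (X : Set (ℤ → A)) (Y : Set (ℤ → B)) : Prop :=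
  ConjugateBy X Y shift shift

/-- `X` is a strong Toeplitz subshift of rank `K`: it is conjugate to the S-adic subshift
of a constant-length, primitive, proper and recognizable directive sequence of
alphabet rank at most `K`. -/
def IsStrongToeplitzOfRank [TopologicalSpace A] (X : Set (ℤ → A)) (K : ℕ) : Prop :=
  ∃ (B : ℕ → Type) (iB : ∀ n, Fintype (B n)) (σ : ∀ n, B (n+1) → List (B n)),
    NonErasing σ ∧ ConstantLength σ ∧ PrimitiveSeq σ ∧ ProperSeq σ ∧
    RecognizableSeq σ ∧ @AlphabetRankLE B iB K ∧
    @Conjugate A (B 0) _ ⊥ X (XLevel σ 0)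

/-- `X` is conjugate to the S-adic subshift of a primitive, proper and recognizable
directive sequence of alphabet rank at most `K`. -/
def HasFiniteRankSAdicRep [TopologicalSpace A] (X : Set (ℤ → A)) (K : ℕ) : Prop :=
  ∃ (B : ℕ → Type) (iB : ∀ n, Fintype (B n)) (σ : ∀ n, B (n+1) → List (B n)),
    NonErasing σ ∧ PrimitiveSeq σ ∧ ProperSeq σ ∧
    RecognizableSeq σ ∧ @AlphabetRankLE B iB K ∧
    @Conjugate A (B 0) _ ⊥ X (XLevel σ 0)

/-! ### Cuts, languages, built-from -/

/-- The set of words `{x[t+kp, t+(k+1)p) : k ∈ ℤ}`. -/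
def cutWords (x : ℤ → A) (p t : ℕ) : Set (List A) :=
  {w | ∃ k : ℤ, w = factorAt x ((t : ℤ) + k * p) p}

/-- `(p, t)` is a strong rank-2 cut of `x`. -/
def StrongRank2Cut (x : ℤ → A) (p t : ℕ) : Prop :=
  t < p ∧ ∃ u v : List A, u ≠ v ∧ cutWords x p t = {u, v}

/-- The language `L_n(X)`. -/
def Lang (n : ℕ) (X : Set (ℤ → A)) : Set (List A) :=
  {w | ∃ x ∈ X, ∃ i : ℤ, w = factorAt x i n}

/-- The maximal common prefix of `u` and `v` has length greater than `m`. -/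
def CommonPrefixLongerThan (u v : List A) (m : ℕ) : Prop :=
  m + 1 ≤ u.length ∧ m + 1 ≤ v.length ∧ u.take (m+1) = v.take (m+1)

/-- The maximal common suffix of `u` and `v` has length greater than `m`. -/
def CommonSuffixLongerThan (u v : List A) (m : ℕ) : Prop :=
  CommonPrefixLongerThan u.reverse v.reverse m

/-- `b = (β₀, (α₁, …, α_k), β₁)` is a building of the word `w` from `W`:
`w = β₀α₁⋯α_kβ₁`, all `αᵢ ∈ W`, `β₀` is a proper suffix of an element of `W`,
and `β₁` is a proper prefix of an element of `W`. -/
def IsBuilding (W : Set (List A)) (w : List A)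
    (b : List A × List (List A) × List A) : Prop :=
  w = b.1 ++ b.2.1.flatten ++ b.2.2 ∧ (∀ α ∈ b.2.1, α ∈ W) ∧
  (∃ u ∈ W, b.1 <:+ u ∧ b.1 ≠ u) ∧ (∃ u ∈ W, b.2.2 <+: u ∧ b.2.2 ≠ u)

/-- `w` is uniquely built from `W`. -/
def UniquelyBuiltFrom (W : Set (List A)) (w : List A) : Prop :=
  ∃! b : List A × List (List A) × List A, IsBuilding W w b

/-- `X` together with one of its points satisfies the strong rank-2 cut property. -/
def GoodCuts [TopologicalSpace A] (X : Set (ℤ → A)) (x : ℤ → A) : Prop :=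
  ∀ p : ℕ, 0 < p → DividesScale X p → ∀ m : ℕ,
    ∃ q t : ℕ, StrongRank2Cut x q t ∧ p ∣ q ∧ DividesScale X q ∧
      ∃ u v : List A, u ≠ v ∧ cutWords x q t = {u, v} ∧
        CommonPrefixLongerThan u v m ∧ CommonSuffixLongerThan u v m

/-! ### Euclidean pairs and buildings of bi-infinite sequences -/

/-- `{u, v}` is a Euclidean pair. -/
def EuclideanPair (u v : List A) : Prop :=
  ∃ (w : List A) (k l : ℕ),
    u = (List.replicate k w).flatten ∧ v = (List.replicate l w).flatten

/-- `α` is the distinguished prefix of `u` and `v`. -/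
def IsDistinguishedPrefix (u v α : List A) : Prop :=
  α.length < u.length + v.length ∧
  ∀ x y : List A,
    (∃ l : List (List A), (∀ w ∈ l, w = u ∨ w = v) ∧ x = u ++ l.flatten) →
    (∃ l : List (List A), (∀ w ∈ l, w = u ∨ w = v) ∧ y = v ++ l.flatten) →
    α.length + 1 ≤ x.length → α.length + 1 ≤ y.length →
    α <+: x ∧ α <+: y ∧ x[α.length]? ≠ y[α.length]?

/-- `β` is the distinguished suffix of `u` and `v`. -/
def IsDistinguishedSuffix (u v β : List A) : Prop :=
  IsDistinguishedPrefix u.reverse v.reverse β.reverse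

/-- `(c, f)` is a building of the bi-infinite sequence `x` from `W`:
block `j` starts at position `c j` and carries the word `f j ∈ W`. -/
def IsBuildingSeq (W : Set (List A)) (x : ℤ → A) (c : ℤ → ℤ) (f : ℤ → List A) : Prop :=
  (∀ j : ℤ, f j ∈ W) ∧ (∀ j : ℤ, c (j + 1) = c j + (f j).length) ∧
  ∀ (j : ℤ) (m : Fin (f j).length), x (c j + (m : ℕ)) = (f j).get m

/-- The subshift `X_{u,v}` of all sequences built from `{u, v}`. -/
def Xuv (u v : List A) : Set (ℤ → A) :=
  {x | ∃ (c : ℤ → ℤ) (f : ℤ → List A), IsBuildingSeq {u, v} x c f}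

/-! ### Block-code conjugacies -/

/-- A conjugacy `φ : X → Y` admitting block width `2n+1`. -/
structure BlockConjugacy (A : Type*) (X Y : Set (ℤ → A)) (n : ℕ) where
  toFun : (ℤ → A) → (ℤ → A)
  invFun : (ℤ → A) → (ℤ → A)
  maps_to : ∀ x ∈ X, toFun x ∈ Y
  maps_from : ∀ y ∈ Y, invFun y ∈ X
  left_inv : ∀ x ∈ X, invFun (toFun x) = x
  right_inv : ∀ y ∈ Y, toFun (invFun y) = y
  shift_comm : ∀ x ∈ X, toFun (shift x) = shift (toFun x)
  code : List A → A
  code_inv : List A → A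
  code_spec : ∀ x ∈ X, ∀ i : ℤ, toFun x i = code (factorAt x (i - n) (2*n+1))
  code_inv_spec : ∀ y ∈ Y, ∀ i : ℤ, invFun y i = code_inv (factorAt y (i - n) (2*n+1))

/-! ### Parts, permutation action, χ -/

/-- `W` is a member of `Parts(X, p)`: a class of the common-`p`-skeleton relation. -/
def SkelClass (X : Set (ℤ → A)) (p : ℕ) (W : Set (ℤ → A)) : Prop :=
  ∃ y ∈ X, W = {z ∈ X | Skel z p = Skel y p}

/-- The map `ψ̂` induced by a permutation `ψ` of `A^p`. -/
def permHat (p : ℕ) (ψ : Equiv.Perm (Fin p → A)) (x : ℤ → A) : ℤ → A :=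
  fun i =>
    if h : (i.emod p).toNat < p then
      ψ (fun m : Fin p => x (i - i.emod p + (m : ℕ))) ⟨(i.emod p).toNat, h⟩
    else x i

/-- The relation `E_p` on compact subsets of `A^ℤ`. -/
def EpRel (p : ℕ) (K L : Set (ℤ → A)) : Prop :=
  ∃ ψ : Equiv.Perm (Fin p → A), L = permHat p ψ '' K

/-- `W ∈ Parts_*(X, p)`. -/
def SkelClassStar (X : Set (ℤ → A)) (p : ℕ) (W : Set (ℤ → A)) : Prop :=
  SkelClass X p W ∧ ∀ y ∈ W, Skel y p (-1) = none ∧ Skel y p 0 ≠ none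

/-- `length(W) = L` for `W ∈ Parts_*(X, p)`. -/
def HasLength (p : ℕ) (W : Set (ℤ → A)) (L : ℕ) : Prop :=
  ∀ y ∈ W, (∀ i : ℕ, i < L → Skel y p (i : ℤ) ≠ none) ∧ Skel y p (L : ℤ) = none

/-- `Z ∈ χ(X, p)`. -/
def ChiMem (X : Set (ℤ → A)) (p : ℕ) (Z : Set (ℤ → A)) : Prop :=
  ∃ (W : Set (ℤ → A)) (L : ℕ), SkelClassStar X p W ∧ HasLength p W L ∧
    (∀ (W' : Set (ℤ → A)) (L' : ℕ),
      SkelClassStar X p W' → HasLength p W' L' → L' ≤ L) ∧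
    Z = shiftBy ((L / 2 : ℕ) : ℤ) '' W

/-- `χ(X, p) E_p^fin χ(Y, p)`. -/
def ChiEpFin (X Y : Set (ℤ → A)) (p : ℕ) : Prop :=
  (∀ K, ChiMem X p K → ∃ L, ChiMem Y p L ∧ EpRel p K L) ∧
  (∀ L, ChiMem Y p L → ∃ K, ChiMem X p K ∧ EpRel p K L)

/-! ### Single holes and fillings -/

/-- The Toeplitz sequence `x` has single holes with respect to the period structure `P`. -/
def SingleHoles (x : ℤ → A) (P : ℕ → ℕ) : Prop :=
  IsPeriodStructure x P ∧
  ∀ n, ∃! i : ℤ, 0 ≤ i ∧ i < (P n : ℤ) ∧ i ∉ PerSet x (P n)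

/-- The Toeplitz subshift `X` has single holes. -/
def HasSingleHoles [TopologicalSpace A] (X : Set (ℤ → A)) : Prop :=
  ∃ (x : ℤ → A) (P : ℕ → ℕ), ToeplitzGenerates x X ∧ SingleHoles x P

/-- `w` is the `(n, m)`-filling of `x` (for periods `pn < pm`). -/
def IsFilling (x : ℤ → A) (pn pm : ℕ) (w : List A) : Prop :=
  w.length = pm / pn - 1 ∧
  ∀ h : ℤ, 0 ≤ h → h < (pm : ℤ) → h ∉ PerSet x pm →
    ∀ (j : ℕ) (hj : j < w.length), w.get ⟨j, hj⟩ = x (h + (j+1) * pn)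

/-- `u` is a `θ`-palindrome. -/
def ThetaPalindrome (θ : Equiv.Perm A) (u : List A) : Prop :=
  u.map (fun a => θ a) = u.reverse

/-! ### Nice symmetries -/

/-- `x` has nice symmetries with respect to `(p, q)`. -/
def NiceSymmetries (x : ℤ → A) (p q : ℕ) : Prop :=
  ∃ m : ℤ, 1 < m ∧ m ≤ (q : ℤ) + 1 ∧
    (∀ k : ℕ, k < q / p →
      (Set.Ico ((k * p : ℕ) : ℤ) (((k+1) * p : ℕ) : ℤ) ⊆ PerSet x q ↔
       Set.Ico (m - ((k+1) * p : ℕ)) (m - (k * p : ℕ)) ⊆ PerSet x q)) ∧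
    (∀ k k' : ℕ, k < q / p → k' < q / p →
      Set.Ico ((k * p : ℕ) : ℤ) (((k+1) * p : ℕ) : ℤ) ⊆ PerSet x q →
      Set.Ico ((k' * p : ℕ) : ℤ) (((k'+1) * p : ℕ) : ℤ) ⊆ PerSet x q →
      (factorAt x ((k * p : ℕ) : ℤ) p = factorAt x ((k' * p : ℕ) : ℤ) p ↔
       factorAt x (m - ((k+1) * p : ℕ)) p = factorAt x (m - ((k'+1) * p : ℕ)) p))

/-- For some `p` dividing the scale of `X`, `x` has nice symmetries with respect to
`(p, q)` for all `q > p` with `p ∣ q` dividing the scale of `X`. -/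
def NiceSymAll [TopologicalSpace A] (X : Set (ℤ → A)) (x : ℤ → A) : Prop :=
  ∃ p : ℕ, 0 < p ∧ DividesScale X p ∧
    ∀ q : ℕ, p < q → p ∣ q → DividesScale X q → NiceSymmetries x p q

/-- A pair `(x, x')` is a centered left asymptotic pair. -/
def CenteredLeftAsymptoticPair (x x' : ℤ → A) : Prop :=
  (∀ i : ℤ, i < 0 → x i = x' i) ∧ x 0 ≠ x' 0

/-! ### Automorphism groups -/

/-- `e` is an automorphism of the subshift `(X, S)`. -/
def IsShiftAutomorphism [TopologicalSpace A] (X : Set (ℤ → A)) (e : ↥X ≃ₜ ↥X) : Prop :=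
  ∀ (x : ℤ → A) (hx : x ∈ X) (hx' : shift x ∈ X),
    (e ⟨shift x, hx'⟩).1 = shift (e ⟨x, hx⟩).1

/-- The automorphism group of `(X, S)` is isomorphic, as a group, to `ℤ × ℤ/nℤ`. -/
def AutGroupIsoZxZmod [TopologicalSpace A] (X : Set (ℤ → A)) (n : ℕ) : Prop :=
  ∃ Φ : {e : ↥X ≃ₜ ↥X // IsShiftAutomorphism X e} → ℤ × ZMod n,
    Function.Bijective Φ ∧
    ∀ e f g : {e : ↥X ≃ₜ ↥X // IsShiftAutomorphism X e},
      (∀ z : ↥X, g.1 z = e.1 (f.1 z)) → Φ g = Φ e + Φ f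

/-! ### The Polish space of subshifts over `ℤ` -/

/-- A point of the space `𝐒` of all (compact, nonempty, shift-invariant) subshifts
over finite alphabets contained in `ℤ`. -/
structure SubshiftSpace : Type where
  carrier : Set (ℤ → ℤ)
  nonempty : carrier.Nonempty
  compact : IsCompact carrier
  invariant : shift '' carrier = carrier

/-- The topology on `𝐒` induced by the languages `(L_n(X))_{n}`, with each
family of `n`-languages discrete; this coincides with the metric
`d(X,Y) = 2^{-min{n : L_n(X) ≠ L_n(Y)}}`. -/
instance : TopologicalSpace SubshiftSpace :=
  TopologicalSpace.induced
    (fun X : SubshiftSpace => (fun n => Lang n X.carrier : ℕ → Set (List ℤ)))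
    (@Pi.topologicalSpace ℕ (fun _ => Set (List ℤ)) (fun _ => ⊥))

/-- The subset `𝐌 ⊆ 𝐒` of infinite minimal subshifts. -/
def MinimalSet : Set SubshiftSpace :=
  {X | X.carrier.Infinite ∧ ∀ x ∈ X.carrier, X.carrier ⊆ closure (orbit x)}

/-! ### The basic two-letter Toeplitz sequence -/

/-- Position of the hole in a basic block. -/
def aN (n : ℕ) : ℕ := n * 2 ^ n

/-- Length of a basic block. -/
def lN (n : ℕ) : ℕ := n * 2 ^ n + n + 1

lemma lN_eq (n : ℕ) : (lN n : ℤ) = aN n + n + 1 := by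
  simp [lN, aN]

lemma lN_pos (n : ℕ) : (0 : ℤ) < lN n := by
  rw [lN_eq]; positivity

lemma n_pos (n : ℕ) [NeZero n] : (0 : ℤ) < n := by
  exact_mod_cast Nat.pos_of_ne_zero (NeZero.ne n)

lemma aN_pos (n : ℕ) [NeZero n] : (0 : ℤ) < aN n := by
  have := Nat.pos_of_ne_zero (NeZero.ne n)
  unfold aN
  positivity

lemma n_lt_aN (n : ℕ) [NeZero n] : (n : ℤ) < aN n := by
  have h := Nat.pos_of_ne_zero (NeZero.ne n)
  have : n < n * 2 ^ n := by
    have : 1 < 2 ^ n := Nat.one_lt_two_pow (NeZero.ne n)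
    nlinarith
  unfold aN
  exact_mod_cast this

/-- The filled part of a basic block. -/
def pat (n : ℕ) (r : ℤ) : Bool := (r / n).toNat.testBit (r % n).toNat

/-- The substitution acting on bi-infinite sequences. -/
def sub (n : ℕ) (Y : ℤ → Bool) (i : ℤ) : Bool :=
  if i % lN n = aN n then Y (i / lN n) else pat n (i % lN n)

lemma tx_term (n : ℕ) [NeZero n] (i : ℤ) (h : i % lN n = aN n) :
    (i / lN n).natAbs < i.natAbs := by
  have h1 := Int.mul_ediv_add_emod i (lN n)
  have h2 := lN_eq n
  have h3 := n_pos n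
  have h4 := aN_pos n
  rw [h] at h1
  generalize i / (lN n : ℤ) = q at *
  rw [← h1, h2]
  rcases le_or_gt 0 q with hq | hq
  · have : 0 ≤ ((aN n : ℤ) + n) * q := by positivity
    have : q < (aN n + n + 1) * q + aN n := by nlinarith
    omega
  · have : ((aN n : ℤ) + n) * q ≤ ((aN n : ℤ) + n) * (-1) := by
      apply mul_le_mul_of_nonneg_left <;> omega
    have : (aN n + n + 1) * q + aN n < q := by nlinarith
    omega

/-- The basic Toeplitz sequence. -/
def tx (n : ℕ) [NeZero n] (i : ℤ) : Bool :=
  if h : i % lN n = aN n then tx n (i / lN n) else pat n (i % lN n)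
termination_by i.natAbs
decreasing_by exact tx_term n i h

lemma tx_eq (n : ℕ) [NeZero n] (i : ℤ) : tx n i = sub n (tx n) i := by
  rw [tx]; simp only [sub]; split_ifs <;> rfl

lemma sub_hole (n : ℕ) [NeZero n] (Y : ℤ → Bool) (j : ℤ) :
    sub n Y (lN n * j + aN n) = Y j := by
  have h2 := lN_eq n
  have h3 := n_pos n
  have h4 := aN_pos n
  have e1 : ((lN n : ℤ) * j + aN n) % lN n = aN n := by
    rw [Int.mul_add_emod_self_left]
    exact Int.emod_eq_of_lt h4.le (by omega)
  have e2 : ((lN n : ℤ) * j + aN n) / lN n = j := by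
    rw [Int.mul_add_ediv_left _ _ (by omega), Int.ediv_eq_zero_of_lt h4.le (by omega)]; simp
  rw [sub, if_pos e1, e2]

lemma sub_of_nonhole (n : ℕ) [NeZero n] (Y : ℤ → Bool) (i : ℤ) (h : ¬ (lN n : ℤ) ∣ i - aN n) :
    sub n Y i = pat n (i % lN n) := by
  rw [sub, if_neg]
  intro h'
  exact h (Int.dvd_self_sub_of_emod_eq h')

/-- The position of the hole in a level `k` block. -/
def hN (n : ℕ) : ℕ → ℤ
  | 0 => 0
  | (k+1) => lN n * hN n k + aN n

/-- `i` is not a hole of level `k`. -/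
def NH (n k : ℕ) (i : ℤ) : Prop := ¬ (lN n : ℤ) ^ k ∣ i - hN n k

lemma NH_add (n k : ℕ) (i t : ℤ) : NH n k (i + lN n ^ k * t) ↔ NH n k i := by
  unfold NH
  rw [show i + (lN n : ℤ) ^ k * t - hN n k = (i - hN n k) + (lN n : ℤ) ^ k * t by ring]
  rw [dvd_add_left (Dvd.intro _ rfl)]

lemma tx_hole (n : ℕ) [NeZero n] (k : ℕ) (j : ℤ) : tx n (lN n ^ k * j + hN n k) = tx n j := by
  induction k with
  | zero => simp [hN]
  | succ k ih =>
    rw [tx_eq, ← ih, ← sub_hole n (tx n)]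
    congr 1
    simp only [hN]; ring

lemma tx_per (n : ℕ) [NeZero n] (k : ℕ) : ∀ (i t : ℤ), NH n k i →
    tx n (i + lN n ^ k * t) = tx n i := by
  induction k with
  | zero => intro i t h; simp [NH] at h
  | succ k ih =>
    intro i t h
    by_cases hi : (lN n : ℤ) ∣ i - aN n
    · obtain ⟨q, hq⟩ := hi
      have e : i = lN n * q + aN n := by linarith
      have h' : NH n k q := by
        intro h''
        apply h
        rw [e, hN, show (lN n : ℤ) * q + aN n - (lN n * hN n k + aN n) =
          lN n * (q - hN n k) by ring, pow_succ']
        exact mul_dvd_mul_left _ h''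
      have e2 : i + lN n ^ (k+1) * t = lN n * (q + lN n ^ k * t) + aN n := by rw [e]; ring
      rw [e2, e, tx_eq n (_ * (_ + _) + _), sub_hole, tx_eq n (_ * q + _), sub_hole, ih _ _ h']
    · have e2 : i + lN n ^ (k+1) * t = i + lN n * (lN n ^ k * t) := by ring
      have hi' : ¬ (lN n : ℤ) ∣ (i + lN n * (lN n ^ k * t)) - aN n := by
        rw [show (i + lN n * (lN n ^ k * t)) - (aN n : ℤ) = (i - aN n) + lN n * (lN n ^ k * t) by
          ring]
        rwa [dvd_add_left (Dvd.intro _ rfl)]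
      rw [e2, tx_eq, sub_of_nonhole _ _ _ hi', tx_eq, sub_of_nonhole _ _ _ hi]
      congr 1
      simp

lemma hN_mul (n k : ℕ) : ((lN n : ℤ) - 1) * hN n k = aN n * (lN n ^ k - 1) := by
  induction k with
  | zero => simp [hN]
  | succ k ih => rw [hN, pow_succ]; linear_combination (lN n : ℤ) * ih

/-- Every bounded window avoids the holes of all sufficiently high levels. -/
lemma exists_NH (n : ℕ) [NeZero n] (M : ℤ) : ∃ K : ℕ, ∀ k, K ≤ k → ∀ i : ℤ, |i| ≤ M → NH n k i := by
  have h2 := lN_eq n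
  have h3 := n_pos n
  have h4 := aN_pos n
  refine ⟨(((lN n : ℤ) - 1) * M + aN n).toNat, fun k hk i hi hd => ?_⟩
  have hd2 : (lN n : ℤ) ^ k ∣ ((lN n : ℤ) - 1) * i + aN n := by
    have e : ((lN n : ℤ) - 1) * i + aN n =
        ((lN n : ℤ) - 1) * (i - hN n k) + lN n ^ k * aN n := by
      have := hN_mul n k
      linear_combination this
    rw [e]
    exact dvd_add (Dvd.dvd.mul_left hd _) (Dvd.intro _ rfl)
  have hne : ((lN n : ℤ) - 1) * i + aN n ≠ 0 := by
    intro h0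
    rw [h2] at h0
    rcases le_or_gt 0 i with hq | hq
    · have : 0 ≤ ((aN n : ℤ) + n + 1 - 1) * i := mul_nonneg (by omega) hq
      omega
    · have : ((aN n : ℤ) + n + 1 - 1) * i ≤ ((aN n : ℤ) + n + 1 - 1) * (-1) := by
        apply mul_le_mul_of_nonneg_left <;> omega
      linarith
  have hle : (lN n : ℤ) ^ k ≤ |((lN n : ℤ) - 1) * i + aN n| :=
    Int.le_of_dvd (abs_pos.mpr hne) ((dvd_abs _ _).mpr hd2)
  have hle2 : |((lN n : ℤ) - 1) * i + aN n| ≤ ((lN n : ℤ) - 1) * M + aN n := by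
    refine (abs_add_le _ _).trans ?_
    rw [abs_mul, abs_of_nonneg (by omega : (0:ℤ) ≤ (lN n : ℤ) - 1), abs_of_pos h4]
    have := mul_le_mul_of_nonneg_left hi (by omega : (0:ℤ) ≤ (lN n : ℤ) - 1)
    linarith
  have hlt : (k : ℤ) < (lN n : ℤ) ^ k := by
    have : 1 < lN n := by
      have := Nat.pos_of_ne_zero (NeZero.ne n); unfold lN; omega
    exact_mod_cast Nat.lt_pow_self this
  omega

/-- Points all of whose windows occur in `x`. -/
def OC (x : ℤ → A) : Set (ℤ → A) :=
  {y | ∀ M : ℕ, ∃ s : ℤ, ∀ i : ℤ, |i| ≤ M → y i = x (i + s)}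

lemma self_mem_OC (x : ℤ → A) : x ∈ OC x := fun _ => ⟨0, fun i _ => by simp⟩

lemma shiftBy_mem_OC (x y : ℤ → A) (hy : y ∈ OC x) (k : ℤ) : shiftBy k y ∈ OC x := by
  intro M
  obtain ⟨s, hs⟩ := hy (M + k.natAbs)
  refine ⟨k + s, fun i hi => ?_⟩
  rw [shiftBy, hs]
  · congr 1; ring
  · have := abs_add_le i k
    push_cast
    omega

lemma tx_zero_pos (n : ℕ) [NeZero n] (t : ℤ) : tx n (lN n * t) = false := by
  have h2 := lN_eq n
  have h3 := n_pos n
  have h4 := aN_pos n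
  rw [tx_eq, sub, if_neg (by simp; omega)]
  simp [pat]

lemma tx_n_pos (n : ℕ) [NeZero n] (t : ℤ) : tx n (lN n * t + n) = true := by
  have h2 := lN_eq n
  have h3 := n_pos n
  have h4 := n_lt_aN n
  have e : ((lN n : ℤ) * t + n) % lN n = n := by
    rw [Int.mul_add_emod_self_left]; exact Int.emod_eq_of_lt h3.le (by omega)
  rw [tx_eq, sub, e, if_neg (by omega)]
  simp [pat, Int.ediv_self h3.ne']

lemma OC_nonconst (n : ℕ) [NeZero n] (y : ℤ → Bool) (hy : y ∈ OC (tx n)) (b : Bool) :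
    ¬ ∀ i, y i = b := by
  intro h
  obtain ⟨s, hs⟩ := hy (lN n)
  have h2 := lN_eq n
  have h3 := n_pos n
  have h4 := n_lt_aN n
  have h5 := Int.mul_ediv_add_emod s (lN n)
  have h6 := Int.emod_nonneg s (lN_pos n).ne'
  have h7 := Int.emod_lt_of_pos s (lN_pos n)
  have e1 := hs (lN n * (s / lN n) - s) (by rw [abs_le]; constructor <;> omega)
  have e2 := hs (lN n * (s / lN n) - s + n) (by rw [abs_le]; constructor <;> omega)
  rw [h, show (lN n : ℤ) * (s / lN n) - s + s = lN n * (s / lN n) by ring, tx_zero_pos] at e1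
  rw [h, show (lN n : ℤ) * (s / lN n) - s + n + s = lN n * (s / lN n) + n by ring, tx_n_pos] at e2
  rw [e1] at e2; cases e2

lemma OC_struct (n : ℕ) [NeZero n] (y : ℤ → Bool) (hy : y ∈ OC (tx n)) (k : ℕ) :
    ∃ r : ℤ, (∀ i, NH n k (i + r) → y i = tx n (i + r)) ∧
      (fun j => y (lN n ^ k * j + hN n k - r)) ∈ OC (tx n) := by
  have hp : (0 : ℤ) < (lN n : ℤ) ^ k := pow_pos (lN_pos n) k
  have key : ∃ r : ℤ, ∀ M : ℕ, ∃ s : ℤ, (lN n : ℤ) ^ k ∣ s - r ∧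
      ∀ i : ℤ, |i| ≤ M → y i = tx n (i + s) := by
    by_contra hcon
    push Not at hcon
    choose f hf using hcon
    obtain ⟨s, hs⟩ := hy ((Finset.Ico 0 ((lN n : ℤ) ^ k)).sup f)
    obtain ⟨i, hi, hne⟩ := hf (s % lN n ^ k) s (Int.dvd_self_sub_emod)
    apply hne
    apply hs
    refine hi.trans ?_
    have : f (s % lN n ^ k) ≤ (Finset.Ico 0 ((lN n : ℤ) ^ k)).sup f := by
      apply Finset.le_sup
      rw [Finset.mem_Ico]
      exact ⟨Int.emod_nonneg _ hp.ne', Int.emod_lt_of_pos _ hp⟩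
    exact_mod_cast this
  obtain ⟨r, hr⟩ := key
  refine ⟨r, fun i hi => ?_, fun M => ?_⟩
  · obtain ⟨s, ⟨t, ht⟩, hs⟩ := hr i.natAbs
    rw [hs i (by simp), ← tx_per n k _ t hi]
    congr 1; linarith
  · obtain ⟨s, ⟨t, ht⟩, hs⟩ := hr (lN n ^ k * M + (hN n k).natAbs + r.natAbs)
    refine ⟨t, fun j hj => ?_⟩
    dsimp only
    rw [hs, ← tx_hole n k (j + t)]
    · congr 1; linear_combination ht
    · have e : |(lN n : ℤ) ^ k * j| ≤ lN n ^ k * M := by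
        rw [abs_mul, abs_of_pos hp]
        exact mul_le_mul_of_nonneg_left hj hp.le
      push_cast
      refine (abs_sub _ _).trans ?_
      have := abs_add_le ((lN n : ℤ) ^ k * j) (hN n k)
      linarith

lemma OC_aper (n : ℕ) [NeZero n] (y : ℤ → Bool) (hy : y ∈ OC (tx n)) (p : ℤ) (hp : p ≠ 0) :
    ¬ ∀ i, y (i + p) = y i := by
  intro h
  have : ∃ k : ℕ, ¬ (lN n : ℤ) ^ k ∣ p := by
    refine ⟨p.natAbs, fun hd => ?_⟩
    have h1 := Int.le_of_dvd (abs_pos.mpr hp) ((dvd_abs _ _).mpr hd)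
    have : 1 < lN n := by
      have := Nat.pos_of_ne_zero (NeZero.ne n); unfold lN; omega
    have h2 : (p.natAbs : ℤ) < (lN n : ℤ) ^ p.natAbs := by exact_mod_cast Nat.lt_pow_self this
    rw [Int.abs_eq_natAbs] at h1
    omega
  obtain ⟨k, hk⟩ := this
  obtain ⟨r, hr, hoc⟩ := OC_struct n y hy k
  have hnh : NH n k (hN n k + p) := by
    unfold NH; rwa [add_sub_cancel_left]
  apply OC_nonconst n _ hoc (tx n (hN n k + p))
  intro j
  rw [← h, hr]
  · rw [← tx_per n k _ j hnh]; congr 1; ring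
  · rw [show (lN n : ℤ) ^ k * j + hN n k - r + p + r = hN n k + p + lN n ^ k * j by ring]
    rwa [NH_add]

/-! ### Generic facts on S-adic subshifts with compatible points -/

lemma factorAt_eq (x : ℤ → A) (i : ℤ) (m : ℕ) :
    factorAt x i m = (List.range m).map (fun j : ℕ => x (i + (j : ℤ))) := by
  have h : ∀ l : List ℕ, l.flatMap (fun a : ℕ => [x (i + (a : ℤ))]) =
      l.map (fun j : ℕ => x (i + (j : ℤ))) := by
    intro l
    induction l with
    | nil => rfl
    | cons a l ih => rw [List.flatMap_cons, ih]; rfl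
  simp only [factorAt, List.bind_eq_flatMap, List.pure_def, List.map_flatMap, List.map_cons,
    List.map_nil]
  exact h _

lemma factorAt_length (x : ℤ → A) (i : ℤ) (m : ℕ) : (factorAt x i m).length = m := by
  simp [factorAt_eq]

lemma factorAt_getElem (x : ℤ → A) (i : ℤ) (m j : ℕ) (h : j < (factorAt x i m).length) :
    (factorAt x i m)[j] = x (i + j) := by
  simp [factorAt_eq]

lemma factorAt_congr (x y : ℤ → A) (i i' : ℤ) (m : ℕ)
    (h : ∀ j : ℕ, j < m → x (i + j) = y (i' + j)) : factorAt x i m = factorAt y i' m := by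
  rw [factorAt_eq, factorAt_eq]
  apply List.map_congr_left
  intro j hj
  exact h j (List.mem_range.mp hj)

lemma factorAt_add (x : ℤ → A) (i : ℤ) (m m' : ℕ) :
    factorAt x i (m + m') = factorAt x i m ++ factorAt x (i + m) m' := by
  simp only [factorAt_eq, List.range_add, List.map_append, List.map_map]
  congr 1
  apply List.map_congr_left
  intro j _
  simp [add_assoc]

lemma factorAt_succ (x : ℤ → A) (i : ℤ) (m : ℕ) :
    factorAt x i (m + 1) = factorAt x i m ++ [x (i + m)] := by
  rw [factorAt_add]; simp [factorAt_eq]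

lemma factorAt_infix (x : ℤ → A) (i : ℤ) (m P : ℕ) (h0 : 0 ≤ i) (h1 : i + m ≤ P) :
    (factorAt x i m).IsInfix (factorAt x 0 P) := by
  obtain ⟨u, rfl⟩ := Int.eq_ofNat_of_zero_le h0
  obtain ⟨v, rfl⟩ : ∃ v, P = u + m + v := ⟨P - (u + m), by omega⟩
  refine ⟨factorAt x 0 u, factorAt x (u + m) v, ?_⟩
  rw [factorAt_add, factorAt_add]
  simp

lemma infix_factorAt (x y : ℤ → A) (i j : ℤ) (m P : ℕ)
    (h : (factorAt y i m).IsInfix (factorAt x j P)) :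
    ∃ s : ℤ, ∀ q : ℕ, q < m → y (i + q) = x (s + q) := by
  obtain ⟨l1, l2, h⟩ := h
  refine ⟨j + l1.length, fun q hq => ?_⟩
  have hlen := congrArg List.length h
  simp only [List.length_append, factorAt_length] at hlen
  have e : (l1 ++ factorAt y i m ++ l2)[l1.length + q]? = (factorAt x j P)[l1.length + q]? := by
    rw [h]
  rw [List.append_assoc, List.getElem?_append_right (by omega), Nat.add_sub_cancel_left,
    List.getElem?_append_left (by rw [factorAt_length]; omega),
    List.getElem?_eq_getElem (by rw [factorAt_length]; omega),
    List.getElem?_eq_getElem (by rw [factorAt_length]; omega),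
    factorAt_getElem, factorAt_getElem] at e
  have := Option.some.inj e
  rw [this]; congr 1; push_cast; ring

lemma factorAt_flatMap {B C : Type*} (x : ℤ → B) (y : ℤ → C) (f : B → List C) (P : ℕ)
    (hf : ∀ i, f (x i) = factorAt y (P * i) P) (i : ℤ) (m : ℕ) :
    (factorAt x i m).flatMap f = factorAt y (P * i) (P * m) := by
  induction m with
  | zero => simp [factorAt_eq]
  | succ m ih =>
    rw [factorAt_succ, List.flatMap_append, ih, Nat.mul_succ, factorAt_add]
    congr 1
    rw [List.flatMap_singleton, hf]
    congr 1; push_cast; ring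

/-- Product of the lengths. -/
def PL (L : ℕ → ℕ) (k : ℕ) : ℕ → ℕ
  | 0 => 1
  | (N+1) => PL L k N * L (k + N)

lemma sadicWord_eq {A : ℕ → Type*} (τ : ∀ n, A (n+1) → List (A n)) (L : ℕ → ℕ)
    (x : ∀ k, ℤ → A k) (hx : ∀ k i, τ k (x (k+1) i) = factorAt (x k) (L k * i) (L k))
    (k N : ℕ) (i : ℤ) :
    sadicWordAux τ k N (x (k + N) i) = factorAt (x k) (PL L k N * i) (PL L k N) := by
  induction N generalizing i with
  | zero => simp [sadicWordAux, PL, factorAt_eq]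
  | succ N ih =>
    rw [sadicWordAux]
    have := hx (k + N) i
    erw [this]
    rw [factorAt_flatMap _ _ _ _ ih, PL]
    congr 1
    push_cast; ring

lemma PL_ge (L : ℕ → ℕ) (hL : ∀ k, 2 ≤ L k) (k N : ℕ) : N < PL L k N := by
  have : 2 ^ N ≤ PL L k N := by
    induction N with
    | zero => simp [PL]
    | succ N ih => rw [PL, pow_succ]; exact Nat.mul_le_mul ih (hL _)
  exact lt_of_lt_of_le Nat.lt_two_pow_self this

lemma XLevel_eq_OC {A : ℕ → Type*} (τ : ∀ n, A (n+1) → List (A n)) (L : ℕ → ℕ)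
    (hL : ∀ k, 2 ≤ L k)
    (x : ∀ k, ℤ → A k) (hx : ∀ k i, τ k (x (k+1) i) = factorAt (x k) (L k * i) (L k))
    (hsurj : ∀ k a, ∃ i, x k i = a)
    (hrec : ∀ k (M : ℕ), ∃ s : ℤ, M ≤ s ∧ ∀ i : ℤ, |i| ≤ M → x k (i + s) = x k i) (k : ℕ) :
    XLevel τ k = OC (x k) := by
  ext y
  constructor
  · intro hy M
    obtain ⟨N, _, a, ha⟩ := hy (-M) (2 * M + 1)
    obtain ⟨i, rfl⟩ := hsurj _ a
    rw [sadicWord_eq τ L x hx] at ha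
    obtain ⟨s, hs⟩ := infix_factorAt _ _ _ _ _ _ ha
    refine ⟨s + M, fun i hi => ?_⟩
    rw [abs_le] at hi
    have := hs (i + M).toNat (by omega)
    rw [Int.toNat_of_nonneg (by omega)] at this
    rw [show i = -M + (i + M) by ring, this]
    congr 1; ring
  · intro hy i m
    obtain ⟨s, hs⟩ := hy (i.natAbs + m)
    obtain ⟨s', hs', hr⟩ := hrec k (i.natAbs + m + s.natAbs)
    push_cast at hs' hs hr
    have e : factorAt y i m = factorAt (x k) (i + s + s') m := by
      apply factorAt_congr
      intro j hj
      rw [hs _ (by rw [abs_le]; constructor <;> cases abs_cases i <;> omega),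
        ← hr _ (by rw [abs_le]; constructor <;> cases abs_cases i <;> cases abs_cases s <;> omega)]
      congr 1; ring
    refine ⟨(i + s + s' + m).toNat + 1, by omega, x _ 0, ?_⟩
    rw [sadicWord_eq τ L x hx, e]
    have := PL_ge L hL k ((i + s + s' + m).toNat + 1)
    rw [mul_zero]
    apply factorAt_infix
    · cases abs_cases i <;> cases abs_cases s <;> omega
    · omega

/-- Concatenations with constant length. -/
lemma isConcat_const {B C : Type*} (σ : B → List C) (L : ℕ) (hL : ∀ b, (σ b).length = L)
    (y : ℤ → B) (z : ℤ → C) (h : IsConcat σ y z) (j : ℤ) :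
    σ (y j) = factorAt z (L * j) L := by
  obtain ⟨c, h0, h1, h2⟩ := h
  have hc : ∀ j, c j = L * j := by
    intro j
    induction j using Int.induction_on with
    | zero => simp [h0]
    | succ i ih => rw [h1, ih, hL]; ring
    | pred i ih =>
      have := h1 (-i - 1)
      rw [hL, sub_add_cancel, ih] at this
      linarith
  apply List.ext_getElem
  · rw [hL, factorAt_length]
  · intro m hm hm'
    rw [factorAt_getElem, ← hc]
    exact (h2 j ⟨m, hm⟩).symm

/-- Membership in closures for the product topology. -/
lemma mem_closure_window [TopologicalSpace A] [DiscreteTopology A] (O : Set (ℤ → A)) (y : ℤ → A) :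
    y ∈ closure O ↔ ∀ M : ℕ, ∃ z ∈ O, ∀ i : ℤ, |i| ≤ M → y i = z i := by
  rw [mem_closure_iff]
  constructor
  · intro h M
    have hopen : IsOpen (Set.pi (Set.Icc (-M : ℤ) M) (fun i => ({y i} : Set A))) :=
      isOpen_set_pi (Set.finite_Icc _ _) (fun _ _ => isOpen_discrete _)
    obtain ⟨z, hz, hzO⟩ := h _ hopen (fun i _ => rfl)
    refine ⟨z, hzO, fun i hi => (hz i (abs_le.mp hi)).symm⟩
  · intro h o ho hy
    obtain ⟨I, u, hu, hsub⟩ := isOpen_pi_iff.mp ho y hy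
    obtain ⟨z, hz, hzi⟩ := h (I.sup Int.natAbs)
    refine ⟨z, hsub ?_, hz⟩
    intro i hi
    rw [← hzi]
    · exact (hu i hi).2
    · have := Finset.le_sup (f := Int.natAbs) hi
      rw [Int.abs_eq_natAbs]; exact_mod_cast this

lemma OC_eq_closure [TopologicalSpace A] [DiscreteTopology A] (x : ℤ → A) :
    OC x = closure (orbit x) := by
  ext y
  rw [mem_closure_window]
  constructor
  · intro h M
    obtain ⟨s, hs⟩ := h M
    exact ⟨shiftBy s x, ⟨s, rfl⟩, hs⟩
  · intro h M
    obtain ⟨z, ⟨s, rfl⟩, hs⟩ := h M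
    exact ⟨s, hs⟩

/-! ### The directive sequence -/

lemma lN_two (n : ℕ) [NeZero n] : 2 ≤ lN n := by
  have := Nat.pos_of_ne_zero (NeZero.ne n); unfold lN; omega

/-- Reduction of an integer to an index in `Fin n`. -/
def fidx (n : ℕ) [NeZero n] (q : ℤ) : Fin n :=
  ⟨(q % n).toNat, by have := Int.emod_lt_of_pos q (n_pos n); have := n_pos n; omega⟩

/-- Grouping letters in blocks of length `n`. -/
def blk (n : ℕ) (Y : ℤ → Bool) : ℤ → Fin n → Bool := fun j c => Y (n * j + (c : ℕ))

/-- Concatenating blocks of length `n`. -/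
def flat (n : ℕ) [NeZero n] (y : ℤ → Fin n → Bool) : ℤ → Bool := fun i => y (i / n) (fidx n i)

/-- Decorating with residues mod `n`. -/
def deco (n : ℕ) (Y : ℤ → Bool) : ℤ → Bool × ZMod n := fun i => (Y i, (i : ZMod n))

lemma fidx_add (n : ℕ) [NeZero n] (j : ℤ) (c : Fin n) : fidx n (n * j + (c : ℕ)) = c := by
  apply Fin.ext
  simp only [fidx, Int.mul_add_emod_self_left]
  rw [Int.emod_eq_of_lt (by omega) (by omega)]
  simp

lemma div_add_fin (n : ℕ) [NeZero n] (j : ℤ) (c : Fin n) : (n * j + ((c : ℕ) : ℤ)) / n = j := by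
  rw [Int.mul_add_ediv_left _ _ (n_pos n).ne', Int.ediv_eq_zero_of_lt (by omega) (by omega)]; simp

lemma flat_add (n : ℕ) [NeZero n] (y : ℤ → Fin n → Bool) (j : ℤ) (c : Fin n) :
    flat n y (n * j + (c : ℕ)) = y j c := by
  rw [flat, fidx_add, div_add_fin]

lemma split_idx (n : ℕ) [NeZero n] (i : ℤ) : i = n * (i / n) + ((fidx n i : ℕ) : ℤ) := by
  have h := Int.mul_ediv_add_emod i n
  have h2 := Int.emod_nonneg i (n_pos n).ne'
  simp only [fidx]
  omega

lemma flat_blk (n : ℕ) [NeZero n] (Y : ℤ → Bool) : flat n (blk n Y) = Y := by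
  funext i
  conv_lhs => rw [split_idx n i, flat_add]
  rw [blk, ← split_idx]

lemma blk_flat (n : ℕ) [NeZero n] (y : ℤ → Fin n → Bool) : blk n (flat n y) = y := by
  funext j c
  rw [blk, flat_add]

lemma flat_mem_OC (n : ℕ) [NeZero n] (Y : ℤ → Bool) (y : ℤ → Fin n → Bool) (hy : y ∈ OC (blk n Y)) :
    flat n y ∈ OC Y := by
  intro M
  obtain ⟨s, hs⟩ := hy M
  refine ⟨n * s, fun i hi => ?_⟩
  rw [flat, hs, blk]
  · congr 1
    conv_rhs => rw [split_idx n i]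
    ring
  · have h3 := n_pos n
    rw [abs_le] at *
    constructor
    · rw [Int.le_ediv_iff_mul_le h3]; nlinarith
    · apply Int.ediv_le_of_le_mul h3; nlinarith

lemma sub_congr (n : ℕ) [NeZero n] (Y Y' : ℤ → Bool) (i t : ℤ)
    (h : Y (i / lN n + t) = Y' (i / lN n)) : sub n Y (i + lN n * t) = sub n Y' i := by
  have h2 := (lN_pos n).ne'
  simp only [sub, Int.add_mul_emod_self_left]
  rw [Int.add_mul_ediv_left _ _ h2, h]

/-- The constant block sequence. -/
def cst (n : ℕ) [NeZero n] (w : Fin n → Bool) : ℤ → Bool := fun q => w (fidx n q)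

/-- The alphabets. -/
def BB (n : ℕ) : ℕ → Type
  | 0 => Bool × ZMod n
  | (_+1) => Fin n → Bool

/-- The finiteness of the alphabets. -/
@[reducible] def iBB (n : ℕ) [NeZero n] : ∀ k, Fintype (BB n k)
  | 0 => inferInstanceAs (Fintype (Bool × ZMod n))
  | (_+1) => inferInstanceAs (Fintype (Fin n → Bool))

/-- The directive sequence. -/
def tau (n : ℕ) [NeZero n] : ∀ k, BB n (k+1) → List (BB n k)
  | 0 => fun w => factorAt (deco n (sub n (cst n w))) 0 (n * lN n)
  | (_+1) => fun w => factorAt (blk n (sub n (cst n w))) 0 (lN n)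

/-- The lengths. -/
def LL (n : ℕ) : ℕ → ℕ
  | 0 => n * lN n
  | (_+1) => lN n

/-- The Toeplitz points at all levels. -/
def xx (n : ℕ) [NeZero n] : ∀ k, ℤ → BB n k
  | 0 => deco n (tx n)
  | (_+1) => blk n (tx n)

lemma LL_two (n : ℕ) [NeZero n] (k : ℕ) : 2 ≤ LL n k := by
  have := lN_two n
  have := Nat.pos_of_ne_zero (NeZero.ne n)
  cases k with
  | zero => simp only [LL]; nlinarith
  | succ k => simpa only [LL]

lemma sub_block (n : ℕ) [NeZero n] (Y : ℤ → Bool) (i m : ℤ) (h0 : 0 ≤ m) (h1 : m < n * lN n) :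
    sub n (cst n (blk n Y i)) m = sub n Y (n * lN n * i + m) := by
  have h2 := lN_pos n
  rw [show (n : ℤ) * lN n * i + m = m + lN n * (n * i) by ring]
  symm
  apply sub_congr
  have h3 : 0 ≤ m / lN n := Int.ediv_nonneg h0 h2.le
  have h4 : m / lN n < n := Int.ediv_lt_of_lt_mul h2 h1
  rw [cst, blk]
  simp only [fidx]
  rw [Int.emod_eq_of_lt h3 h4, Int.toNat_of_nonneg h3]
  congr 1; ring

lemma flat_sub_block (n : ℕ) [NeZero n] (y : ℤ → Fin n → Bool) (i m : ℤ) (h0 : 0 ≤ m)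
    (h1 : m < n * lN n) :
    sub n (cst n (y i)) m = sub n (flat n y) (n * lN n * i + m) := by
  rw [← sub_block n _ i m h0 h1, blk_flat]

lemma tau_zero (n : ℕ) [NeZero n] (y : ℤ → Fin n → Bool) (i : ℤ) :
    tau n 0 (y i) = factorAt (deco n (sub n (flat n y))) ((n * lN n : ℕ) * i) (n * lN n) := by
  apply factorAt_congr
  intro j hj
  have hj' : (j : ℤ) < n * lN n := by exact_mod_cast hj
  rw [zero_add, deco, deco, flat_sub_block n y i j (by omega) hj']
  simp
  rfl

lemma tau_succ (n k : ℕ) [NeZero n] (y : ℤ → Fin n → Bool) (i : ℤ) :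
    tau n (k+1) (y i) = factorAt (blk n (sub n (flat n y))) ((lN n : ℕ) * i) (lN n) := by
  apply factorAt_congr
  intro j hj
  have hj' : (j : ℤ) < lN n := by exact_mod_cast hj
  funext c
  have h3 := n_pos n
  rw [zero_add, blk, blk, flat_sub_block n y i _ (by positivity)]
  · congr 1; ring
  · have : (n : ℤ) * (j + 1) ≤ n * lN n := by apply mul_le_mul_of_nonneg_left <;> omega
    have := c.2
    linarith [(by exact_mod_cast this : ((c : ℕ) : ℤ) < n)]

lemma sub_tx (n : ℕ) [NeZero n] : sub n (tx n) = tx n := by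
  funext i; rw [← tx_eq]

lemma hxx (n : ℕ) [NeZero n] (k : ℕ) (i : ℤ) :
    tau n k (xx n (k+1) i) = factorAt (xx n k) (LL n k * i) (LL n k) := by
  cases k with
  | zero =>
    have := tau_zero n (blk n (tx n)) i
    rw [flat_blk, sub_tx] at this
    exact this
  | succ k =>
    have := tau_succ n k (blk n (tx n)) i
    rw [flat_blk, sub_tx] at this
    exact this

/-- All words of length `n` appear at the beginning of every block. -/
lemma sub_word (n : ℕ) [NeZero n] (Y : ℤ → Bool) (w : Fin n → Bool) :
    ∃ t : ℕ, t < 2 ^ n ∧ ∀ c : Fin n, sub n Y (n * t + (c : ℕ)) = w c := by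
  refine ⟨Nat.ofBits w, Nat.ofBits_lt_two_pow w, fun c => ?_⟩
  have h := Nat.ofBits_lt_two_pow w
  generalize hT : Nat.ofBits w = T at *
  have h1 : ((n * T + (c : ℕ) : ℕ) : ℤ) < aN n := by
    unfold aN
    have : n * (T + 1) ≤ n * 2 ^ n := Nat.mul_le_mul_left _ h
    have := c.2
    have : n * T + (c : ℕ) < n * 2 ^ n := by linarith
    exact_mod_cast this
  push_cast at h1
  have h2 := lN_eq n
  have h3 := n_pos n
  have e : ((n : ℤ) * T + (c : ℕ)) % lN n = n * T + (c : ℕ) :=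
    Int.emod_eq_of_lt (by positivity) (by omega)
  rw [sub, e, if_neg (by omega), pat, div_add_fin]
  have e2 : (((n : ℤ) * T + (c : ℕ)) % n).toNat = c := congrArg Fin.val (fidx_add n T c)
  rw [e2]
  simp only [Int.toNat_natCast]
  rw [← hT, Nat.testBit_ofBits_lt _ _ c.2]

lemma xx_surj (n : ℕ) [NeZero n] (k : ℕ) (a : BB n k) : ∃ i, xx n k i = a := by
  cases k with
  | zero =>
    obtain ⟨b, c⟩ := a
    obtain ⟨t, -, ht⟩ := sub_word n (tx n) (fun _ => b)
    refine ⟨n * t + ((fidx n (c.val : ℤ) : ℕ) : ℤ), ?_⟩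
    show deco n (tx n) _ = (b, c)
    rw [deco, ← sub_tx, ht]
    congr 1
    have := congrArg (fun i : ℤ => (i : ZMod n)) (split_idx n (c.val : ℤ))
    simp at this
    simp [← this]
  | succ k =>
    obtain ⟨t, -, ht⟩ := sub_word n (tx n) a
    refine ⟨t, ?_⟩
    funext c
    show blk n (tx n) _ c = _
    rw [blk, ← sub_tx, ht]

lemma tau_prim (n : ℕ) [NeZero n] (k : ℕ) (a : BB n (k+1)) (b : BB n k) : b ∈ tau n k a := by
  have h3 := n_pos n
  have hmem : ∀ {D : Type} (x : ℤ → D) (m j : ℕ), j < m → x j ∈ factorAt x 0 m := by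
    intro D x m j hj
    rw [factorAt_eq, List.mem_map]
    exact ⟨j, List.mem_range.mpr hj, by simp⟩
  have hl : n * 2 ^ n ≤ lN n := by unfold lN; omega
  cases k with
  | zero =>
    obtain ⟨b, c⟩ := b
    obtain ⟨t, ht2, ht⟩ := sub_word n (cst n a) (fun _ => b)
    have hc := (fidx n (c.val : ℤ)).2
    have hlt : n * t + (fidx n (c.val : ℤ) : ℕ) < n * lN n := by
      have h5 : n * (t + 1) ≤ n * 2 ^ n := Nat.mul_le_mul_left _ ht2
      have h6 : lN n ≤ n * lN n := Nat.le_mul_of_pos_left _ (by omega)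
      linarith
    have := hmem (deco n (sub n (cst n a))) _ _ hlt
    have e : deco n (sub n (cst n a)) ((n * t + (fidx n (c.val : ℤ) : ℕ) : ℕ) : ℤ) = (b, c) := by
      rw [deco]
      push_cast
      rw [ht]
      congr 1
      have := congrArg (fun i : ℤ => (i : ZMod n)) (split_idx n (c.val : ℤ))
      simp at this
      simp [← this]
    rw [e] at this
    exact this
  | succ k =>
    obtain ⟨t, ht2, ht⟩ := sub_word n (cst n a) b
    have hlt : t < lN n := by
      have : 2 ^ n ≤ n * 2 ^ n := Nat.le_mul_of_pos_left _ (by omega)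
      omega
    have := hmem (blk n (sub n (cst n a))) _ _ hlt
    have e : blk n (sub n (cst n a)) t = b := by
      funext c
      rw [blk, ht]
    rw [e] at this
    exact this

lemma xx_rec (n : ℕ) [NeZero n] (k M : ℕ) :
    ∃ s : ℤ, M ≤ s ∧ ∀ i : ℤ, |i| ≤ M → xx n k (i + s) = xx n k i := by
  have h3 := n_pos n
  obtain ⟨K, hK⟩ := exists_NH n (n * M + n)
  have hp : (0 : ℤ) < (lN n : ℤ) ^ K := pow_pos (lN_pos n) K
  have hM : (M : ℤ) ≤ lN n ^ K * M := by nlinarith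
  cases k with
  | zero =>
    refine ⟨lN n ^ K * (n * M), by nlinarith, fun i hi => ?_⟩
    show deco n (tx n) _ = deco n (tx n) _
    rw [deco, deco, tx_per n K _ _ (hK K le_rfl i (by nlinarith))]
    simp
  | succ k =>
    refine ⟨lN n ^ K * M, hM, fun i hi => ?_⟩
    show blk n (tx n) _ = blk n (tx n) _
    funext c
    rw [blk, blk, ← tx_per n K (n * i + (c : ℕ)) (n * M)]
    · congr 1; ring
    · apply hK K le_rfl
      refine (abs_add_le _ _).trans ?_
      rw [abs_mul, abs_of_pos h3]
      have := mul_le_mul_of_nonneg_left hi h3.le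
      have h5 := c.2
      have h6 : |((c : ℕ) : ℤ)| = (c : ℕ) := abs_of_nonneg (by omega)
      omega

lemma tau_XLevel (n : ℕ) [NeZero n] (k : ℕ) : XLevel (tau n) k = OC (xx n k) :=
  XLevel_eq_OC (tau n) (LL n) (LL_two n) (xx n) (hxx n) (xx_surj n) (xx_rec n) k

lemma tau_length (n : ℕ) [NeZero n] (k : ℕ) (a : BB n (k+1)) : (tau n k a).length = LL n k := by
  obtain ⟨i, rfl⟩ := xx_surj n _ a
  rw [hxx, factorAt_length]

lemma tau_nonErasing (n : ℕ) [NeZero n] : NonErasing (tau n) := by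
  intro k a h
  have h1 := tau_length n k a
  have := LL_two n k
  rw [h] at h1
  simp at h1
  omega

lemma tau_constantLength (n : ℕ) [NeZero n] : ConstantLength (tau n) := by
  intro k a b
  rw [tau_length, tau_length]

lemma tau_primitive (n : ℕ) [NeZero n] : PrimitiveSeq (tau n) := by
  intro k
  refine ⟨1, one_pos, fun a b => ?_⟩
  simp only [sadicWordAux]
  rw [List.mem_flatMap]
  exact ⟨b, tau_prim n k a b, by simp⟩

lemma tau_proper (n : ℕ) [NeZero n] : ProperSeq (tau n) := by
  intro k
  have h2 := lN_eq n
  have h3 := n_pos n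
  have h4 := n_lt_aN n
  -- it suffices to show that first and last letters of two images agree
  have key : ∀ a b : BB n (k+1), (tau n k a).head? = (tau n k b).head? ∧
      (tau n k a).getLast? = (tau n k b).getLast? := by
    have hhd : ∀ {D : Type} (x y : ℤ → D) (m : ℕ), x 0 = y 0 →
        (factorAt x 0 (m+1)).head? = (factorAt y 0 (m+1)).head? := by
      intro D x y m h
      rw [add_comm m 1, factorAt_add, factorAt_add]
      simp [factorAt_eq, h]
    have hlast : ∀ {D : Type} (x y : ℤ → D) (m : ℕ), x m = y m →
        (factorAt x 0 (m+1)).getLast? = (factorAt y 0 (m+1)).getLast? := by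
      intro D x y m h
      rw [factorAt_succ, factorAt_succ]
      simp [h]
    have hfirst : ∀ (Y Y' : ℤ → Bool) (i : ℤ), 0 ≤ i → i < n → sub n Y i = sub n Y' i := by
      intro Y Y' i hi hi'
      have e : i % lN n = i := Int.emod_eq_of_lt hi (by omega)
      rw [sub, sub, e, if_neg (by omega), if_neg (by omega)]
    have hend : ∀ (Y Y' : ℤ → Bool) (i : ℤ), 0 ≤ i → i < n →
        sub n Y (n * lN n - 1 - i) = sub n Y' (n * lN n - 1 - i) := by
      intro Y Y' i hi hi'
      have e : ((n : ℤ) * lN n - 1 - i) % lN n = lN n - 1 - i := by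
        rw [show (n : ℤ) * lN n - 1 - i = (lN n - 1 - i) + lN n * (n - 1) by ring,
          Int.add_mul_emod_self_left]
        exact Int.emod_eq_of_lt (by omega) (by omega)
      rw [sub, sub, e, if_neg (by omega), if_neg (by omega)]
    intro a b
    cases k with
    | zero =>
      obtain ⟨m, hm⟩ : ∃ m, n * lN n = m + 1 :=
        ⟨n * lN n - 1, by have := LL_two n 0; simp only [LL] at this; omega⟩
      have hm' : (m : ℤ) = n * lN n - 1 - 0 := by
        have : ((n * lN n : ℕ) : ℤ) = m + 1 := by rw [hm]; push_cast; rfl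
        push_cast at this; omega
      simp only [tau]
      rw [hm]
      constructor
      · apply hhd
        rw [deco, deco, hfirst _ (cst n b) 0 le_rfl h3]
      · apply hlast
        rw [deco, deco, hm', hend _ (cst n b) 0 le_rfl h3]
    | succ k =>
      obtain ⟨m, hm⟩ : ∃ m, lN n = m + 1 := ⟨lN n - 1, by have := lN_two n; omega⟩
      have hm' : (m : ℤ) = lN n - 1 := by rw [hm]; push_cast; ring
      simp only [tau]
      rw [hm]
      constructor
      · apply hhd
        funext c
        rw [blk, blk]
        apply hfirst
        · omega
        · have := c.2; omega
      · apply hlast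
        funext c
        have := c.2
        rw [blk, blk, hm']
        rw [show (n : ℤ) * (lN n - 1) + (c : ℕ) = n * lN n - 1 - (n - 1 - (c : ℕ)) by ring]
        apply hend <;> omega
  have a0 : BB n (k+1) := fun _ => false
  have hne := tau_nonErasing n k a0
  refine ⟨(tau n k a0).head hne, (tau n k a0).getLast hne, fun a => ?_⟩
  rw [(key a a0).1, (key a a0).2]
  exact ⟨List.head?_eq_some_head hne, List.getLast?_eq_some_getLast hne⟩

lemma factorAt_inj {D : Type*} (x y : ℤ → D) (L : ℕ) (hL : 0 < L)
    (h : ∀ j : ℤ, factorAt x (L * j) L = factorAt y (L * j) L) : x = y := by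
  funext i
  have h1 := Int.mul_ediv_add_emod i L
  have h2 := Int.emod_nonneg i (by omega : (L : ℤ) ≠ 0)
  have h3 := Int.emod_lt_of_pos i (by omega : (0 : ℤ) < L)
  have e := h (i / L)
  have hlt : (i % L).toNat < (factorAt x (L * (i / L)) L).length := by
    rw [factorAt_length]; omega
  have hlt' : (i % L).toNat < (factorAt y (L * (i / L)) L).length := by
    rw [factorAt_length]; omega
  have e2 : (factorAt x (L * (i / L)) L)[(i % L).toNat]'hlt =
      (factorAt y (L * (i / L)) L)[(i % L).toNat]'hlt' := by
    congr 1
  rw [factorAt_getElem, factorAt_getElem, Int.toNat_of_nonneg h2, h1] at e2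
  exact e2

/-- The key recognizability fact. -/
lemma sub_recog (n : ℕ) [NeZero n] (Y Y' : ℤ → Bool) (hY : Y ∈ OC (tx n)) (P : ℤ → Bool) (d d' : ℤ)
    (h : ∀ i, P (i - d) = sub n Y i) (h' : ∀ i, P (i - d') = sub n Y' i) :
    (lN n : ℤ) ∣ d - d' := by
  by_contra hd
  apply OC_nonconst n Y hY (pat n ((aN n - d + d') % lN n))
  intro j
  have e := h (lN n * j + aN n)
  rw [sub_hole] at e
  rw [← e, show (lN n : ℤ) * j + aN n - d = (lN n * j + aN n - d + d') - d' by ring, h',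
    sub_of_nonhole]
  · congr 1
    rw [show (lN n : ℤ) * j + aN n - d + d' = lN n * j + (aN n - d + d') by ring,
      Int.mul_add_emod_self_left]
  · intro hd2
    apply hd
    rw [show (lN n : ℤ) * j + aN n - d + d' - aN n = lN n * j - (d - d') by ring] at hd2
    exact (dvd_sub_right (Dvd.intro _ rfl)).mp hd2

lemma flat_inj (n : ℕ) [NeZero n] (y y' : ℤ → Fin n → Bool)
    (h : sub n (flat n y) = sub n (flat n y')) : y = y' := by
  rw [← blk_flat n y, ← blk_flat n y']
  congr 1
  funext j
  rw [← sub_hole n (flat n y), h, sub_hole]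

lemma lN_coprime (n : ℕ) : IsCoprime (lN n : ℤ) n := by
  refine ⟨1, -(2 ^ n + 1), ?_⟩
  simp only [lN]; push_cast; ring

lemma eq_of_dvd (L k k' : ℕ) (hk : k < L) (hk' : k' < L) (h : (L : ℤ) ∣ (k : ℤ) - k') : k = k' := by
  obtain ⟨t, ht⟩ := h
  have h0 : (0 : ℤ) < L := by omega
  have : t < 1 := by by_contra hc; nlinarith
  have : -1 < t := by by_contra hc; nlinarith
  have : t = 0 := by omega
  subst this
  omega

lemma tau_recognizable (n : ℕ) [NeZero n] : RecognizableSeq (tau n) := by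
  intro m x y y' k k' ⟨hy, hk, hc⟩ ⟨hy', hk', hc'⟩
  have hL := LL_two n m
  have e := isConcat_const (tau n m) (LL n m) (tau_length n m) _ _ hc
  have e' := isConcat_const (tau n m) (LL n m) (tau_length n m) _ _ hc'
  rw [tau_length] at hk hk'
  rw [tau_XLevel] at hy hy'
  have hfy : flat n y ∈ OC (tx n) := flat_mem_OC n (tx n) y hy
  cases m with
  | zero =>
    have f : (fun m : ℤ => x (m - k)) = deco n (sub n (flat n y)) := by
      apply factorAt_inj _ _ (n * lN n) (by simp only [LL] at hL; omega)
      intro j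
      exact (e j).symm.trans (tau_zero n y j)
    have f' : (fun m : ℤ => x (m - k')) = deco n (sub n (flat n y')) := by
      apply factorAt_inj _ _ (n * lN n) (by simp only [LL] at hL; omega)
      intro j
      exact (e' j).symm.trans (tau_zero n y' j)
    have d1 := sub_recog n (flat n y) (flat n y') hfy (fun i => (x i : Bool × ZMod n).1) k k'
      (fun i => congrArg Prod.fst (congrFun f i)) (fun i => congrArg Prod.fst (congrFun f' i))
    have d2 : (n : ℤ) ∣ (k : ℤ) - k' := by
      have g1 := congrArg Prod.snd (congrFun f k)
      have g2 := congrArg Prod.snd (congrFun f' k')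
      simp only [sub_self, deco] at g1 g2
      have g3 := g2.symm.trans g1
      rw [ZMod.intCast_eq_intCast_iff_dvd_sub] at g3
      exact g3
    have hkk : k = k' := by
      apply eq_of_dvd (n * lN n) _ _ hk hk'
      push_cast
      exact (lN_coprime n).symm.mul_dvd d2 d1
    refine ⟨?_, hkk⟩
    subst hkk
    apply flat_inj
    funext i
    exact congrArg Prod.fst (congrFun (f.symm.trans f') i)
  | succ m =>
    have f : (fun m : ℤ => x (m - k)) = blk n (sub n (flat n y)) := by
      apply factorAt_inj _ _ (lN n) (by simp only [LL] at hL; omega)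
      intro j
      exact (e j).symm.trans (tau_succ n m y j)
    have f' : (fun m : ℤ => x (m - k')) = blk n (sub n (flat n y')) := by
      apply factorAt_inj _ _ (lN n) (by simp only [LL] at hL; omega)
      intro j
      exact (e' j).symm.trans (tau_succ n m y' j)
    have hP : ∀ (k : ℕ) (Y : ℤ → Bool), (fun m : ℤ => x (m - k)) = blk n Y →
        ∀ i, flat n x (i - n * k) = Y i := by
      intro k Y hf i
      have h1 := congrFun (congrFun hf (i / n)) (fidx n i)
      rw [blk, ← split_idx] at h1
      rw [← h1]
      conv_lhs => rw [split_idx n i]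
      rw [show (n : ℤ) * (i / n) + ((fidx n i : ℕ) : ℤ) - n * k =
        n * (i / n - k) + ((fidx n i : ℕ) : ℤ) by ring]
      exact flat_add n x _ _
    have d1 := sub_recog n (flat n y) (flat n y') hfy (flat n x) _ _ (hP k _ f) (hP k' _ f')
    have hkk : k = k' := by
      apply eq_of_dvd (lN n) _ _ hk hk'
      rw [← mul_sub] at d1
      exact (lN_coprime n).dvd_of_dvd_mul_left d1
    refine ⟨?_, hkk⟩
    subst hkk
    apply flat_inj
    rw [← flat_blk n (sub n (flat n y)), ← flat_blk n (sub n (flat n y')), ← f, ← f']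

lemma tau_rank (n : ℕ) [NeZero n] : @AlphabetRankLE (BB n) (iBB n) (max 2 (n ^ n)) := by
  intro N
  refine ⟨N + 1, by omega, ?_⟩
  have : @Fintype.card (BB n (N+1)) (iBB n (N+1)) = 2 ^ n := by
    show Fintype.card (Fin n → Bool) = 2 ^ n
    simp
  rw [this]
  rcases Nat.lt_or_ge n 2 with h | h
  · have : n = 1 := by have := Nat.pos_of_ne_zero (NeZero.ne n); omega
    subst this; simp
  · exact le_max_of_le_right (Nat.pow_le_pow_left h n)

/-! ### Toeplitz property, aperiodicity, automorphisms -/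

lemma deco_toeplitz (n : ℕ) [NeZero n] : IsToeplitz (deco n (tx n)) := by
  intro i
  obtain ⟨K, hK⟩ := exists_NH n |i|
  have hl := lN_two n
  have hn := Nat.pos_of_ne_zero (NeZero.ne n)
  refine ⟨n * lN n ^ (K + 1), ?_, fun k => ?_⟩
  · have h1 : 1 < lN n ^ (K+1) := Nat.one_lt_pow (by omega) (by omega)
    exact lt_of_lt_of_le h1 (Nat.le_mul_of_pos_left _ hn)
  · rw [deco, deco]
    have e : i + k * ((n * lN n ^ (K + 1) : ℕ) : ℤ) = i + lN n ^ (K+1) * (k * n) := by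
      push_cast; ring
    rw [e, tx_per n (K+1) i _ (hK (K+1) (by omega) i le_rfl)]
    simp

lemma fst_mem_OC (n : ℕ) [NeZero n] (z : ℤ → Bool × ZMod n) (hz : z ∈ OC (deco n (tx n))) :
    (fun i => (z i).1) ∈ OC (tx n) := by
  intro M
  obtain ⟨s, hs⟩ := hz M
  exact ⟨s, fun i hi => by dsimp only; rw [hs i hi]; rfl⟩

lemma snd_of_mem_OC (n : ℕ) [NeZero n] (z : ℤ → Bool × ZMod n) (hz : z ∈ OC (deco n (tx n)))
    (i : ℤ) : (z i).2 = (z 0).2 + i := by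
  obtain ⟨s, hs⟩ := hz i.natAbs
  rw [hs i (by simp), hs 0 (by simp)]
  simp [deco, add_comm]

lemma deco_aper (n : ℕ) [NeZero n] (z : ℤ → Bool × ZMod n) (hz : z ∈ OC (deco n (tx n))) :
    IsAperiodicPoint z := by
  rintro ⟨p, hp, h⟩
  apply OC_aper n _ (fst_mem_OC n z hz) p (by omega)
  intro i
  rw [h]

/-- The candidate automorphisms. -/
def TT (n : ℕ) (p : ℤ × ZMod n) (z : ℤ → Bool × ZMod n) : ℤ → Bool × ZMod n :=
  fun i => ((z (i + p.1)).1, (z (i + p.1)).2 + p.2)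

lemma TT_add (n : ℕ) (p q : ℤ × ZMod n) (z : ℤ → Bool × ZMod n) :
    TT n (p + q) z = TT n p (TT n q z) := by
  funext i
  simp only [TT, Prod.fst_add, Prod.snd_add, add_assoc]
  rw [add_comm q.2 p.2]

lemma TT_zero (n : ℕ) (z : ℤ → Bool × ZMod n) : TT n 0 z = z := by
  funext i; simp [TT]

lemma lN_cast (n : ℕ) : ((lN n : ℕ) : ZMod n) = 1 := by
  simp [lN]

lemma TT_mem (n : ℕ) [NeZero n] (p : ℤ × ZMod n) (z : ℤ → Bool × ZMod n)
    (hz : z ∈ OC (deco n (tx n))) : TT n p z ∈ OC (deco n (tx n)) := by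
  intro M
  obtain ⟨s, hs⟩ := hz (M + p.1.natAbs)
  obtain ⟨K, hK⟩ := exists_NH n (M + |p.1 + s|)
  refine ⟨p.1 + s + lN n ^ K * (p.2.val : ℤ), fun i hi => ?_⟩
  have h1 : |i + p.1| ≤ ((M + p.1.natAbs : ℕ) : ℤ) := by
    have := abs_add_le i p.1
    push_cast
    omega
  have h2 : NH n K (i + (p.1 + s)) := by
    apply hK K le_rfl
    have := abs_add_le i (p.1 + s)
    omega
  rw [TT, hs _ h1, deco, deco]
  dsimp only
  rw [show i + (p.1 + s + (lN n : ℤ) ^ K * (p.2.val : ℤ)) =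
    i + (p.1 + s) + (lN n : ℤ) ^ K * (p.2.val : ℤ) by ring, tx_per n K _ _ h2, add_assoc i]
  congr 1
  push_cast
  rw [lN_cast]
  simp

lemma TT_inj (n : ℕ) [NeZero n] (p q : ℤ × ZMod n)
    (h : TT n p (deco n (tx n)) = TT n q (deco n (tx n))) : p = q := by
  have h1 : p.1 = q.1 := by
    by_contra hne
    apply OC_aper n (tx n) (self_mem_OC _) (p.1 - q.1) (sub_ne_zero.mpr hne)
    intro i
    have := congrArg Prod.fst (congrFun h (i - q.1))
    simp only [TT, deco, sub_add_cancel] at this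
    rw [← this]
    congr 1; ring
  apply Prod.ext h1
  have := congrArg Prod.snd (congrFun h 0)
  simpa [TT, deco, h1] using this

section Aut

variable (n : ℕ) [NeZero n]

/-- The subshift. -/
def XD : Set (ℤ → Bool × ZMod n) := OC (deco n (tx n))

lemma deco_mem : deco n (tx n) ∈ XD n := self_mem_OC _

lemma shift_mem (z : ℤ → Bool × ZMod n) (hz : z ∈ XD n) : shift z ∈ XD n :=
  shiftBy_mem_OC _ _ hz 1

variable [TopologicalSpace (Bool × ZMod n)] [DiscreteTopology (Bool × ZMod n)]

/-- The candidate automorphisms as homeomorphisms. -/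
def TH (p : ℤ × ZMod n) : ↥(XD n) ≃ₜ ↥(XD n) where
  toFun z := ⟨TT n p z.1, TT_mem n p z.1 z.2⟩
  invFun z := ⟨TT n (-p) z.1, TT_mem n (-p) z.1 z.2⟩
  left_inv z := by
    apply Subtype.ext
    show TT n (-p) (TT n p z.1) = z.1
    rw [← TT_add, neg_add_cancel, TT_zero]
  right_inv z := by
    apply Subtype.ext
    show TT n p (TT n (-p) z.1) = z.1
    rw [← TT_add, add_neg_cancel, TT_zero]
  continuous_toFun := by
    apply Continuous.subtype_mk
    apply continuous_pi
    intro i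
    exact (continuous_of_discreteTopology (f := fun a : Bool × ZMod n => (a.1, a.2 + p.2))).comp
      ((continuous_apply (i + p.1)).comp continuous_subtype_val)
  continuous_invFun := by
    apply Continuous.subtype_mk
    apply continuous_pi
    intro i
    exact (continuous_of_discreteTopology (f := fun a : Bool × ZMod n => (a.1, a.2 + (-p).2))).comp
      ((continuous_apply (i + (-p).1)).comp continuous_subtype_val)

lemma TH_aut (p : ℤ × ZMod n) : IsShiftAutomorphism (XD n) (TH n p) := by
  intro x hx hx'
  funext i
  show TT n p (shift x) i = TT n p x (i + 1)
  simp only [TT, shift]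
  rw [show i + p.1 + 1 = i + 1 + p.1 by ring]

lemma XD_compact : CompactSpace ↥(XD n) := by
  rw [← isCompact_iff_compactSpace]
  have : XD n = closure (orbit (deco n (tx n))) := OC_eq_closure _
  rw [this]
  haveI : CompactSpace (Bool × ZMod n) := Finite.compactSpace
  exact isClosed_closure.isCompact

/-- Automorphisms are given by a local rule. -/
lemma local_rule (e : ↥(XD n) → ↥(XD n)) (he : Continuous e) :
    ∃ M : ℕ, ∀ z z' : ↥(XD n), (∀ i : ℤ, |i| ≤ M → z.1 i = z'.1 i) → (e z).1 0 = (e z').1 0 := by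
  haveI := XD_compact n
  have hf : Continuous (fun z : ↥(XD n) => (e z).1 0) :=
    (continuous_apply 0).comp (continuous_subtype_val.comp he)
  have main : ∃ M : ℕ, ∀ z ∈ (Set.univ : Set ↥(XD n)), ∀ z' : ↥(XD n),
      (∀ i : ℤ, |i| ≤ M → z.1 i = z'.1 i) → (e z).1 0 = (e z').1 0 := by
    refine isCompact_univ.induction_on (p := fun s : Set ↥(XD n) => ∃ M : ℕ, ∀ z ∈ s,
      ∀ z' : ↥(XD n), (∀ i : ℤ, |i| ≤ M → z.1 i = z'.1 i) → (e z).1 0 = (e z').1 0) ?_ ?_ ?_ ?_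
    · exact ⟨0, fun z hz => absurd hz (Set.notMem_empty z)⟩
    · rintro s t hst ⟨M, hM⟩
      exact ⟨M, fun z hz => hM z (hst hz)⟩
    · rintro s t ⟨M, hM⟩ ⟨M', hM'⟩
      refine ⟨max M M', fun z hz z' h => ?_⟩
      rcases hz with hz | hz
      · exact hM z hz z' fun i hi => h i (hi.trans (by simp))
      · exact hM' z hz z' fun i hi => h i (hi.trans (by simp))
    · intro z _
      have hopen : IsOpen ((fun z : ↥(XD n) => (e z).1 0) ⁻¹' {(e z).1 0}) :=
        (isOpen_discrete _).preimage hf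
      obtain ⟨U, hU, hUeq⟩ := isOpen_induced_iff.mp hopen
      have hzU : z.1 ∈ U := by
        have : z ∈ Subtype.val ⁻¹' U := by rw [hUeq]; rfl
        exact this
      obtain ⟨I, u, hu, hsub⟩ := isOpen_pi_iff.mp hU z.1 hzU
      have hcyl : ∀ w : ↥(XD n), (∀ i : ℤ, |i| ≤ ((I.sup Int.natAbs : ℕ) : ℤ) → z.1 i = w.1 i) →
          (e w).1 0 = (e z).1 0 := by
        intro w hw
        have hwU : w ∈ Subtype.val ⁻¹' U := by
          apply hsub
          intro i hi
          rw [← hw]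
          · exact (hu i hi).2
          · have := Finset.le_sup (f := Int.natAbs) hi
            rw [Int.abs_eq_natAbs]; exact_mod_cast this
        rw [hUeq] at hwU
        exact hwU
      refine ⟨{w : ↥(XD n) | ∀ i : ℤ, |i| ≤ ((I.sup Int.natAbs : ℕ) : ℤ) → z.1 i = w.1 i}, ?_,
        I.sup Int.natAbs, fun w hw w' h => ?_⟩
      · apply mem_nhdsWithin_of_mem_nhds
        have ho : IsOpen (Set.pi (Set.Icc (-(I.sup Int.natAbs : ℕ) : ℤ) (I.sup Int.natAbs : ℕ))
            (fun i => ({z.1 i} : Set (Bool × ZMod n)))) :=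
          isOpen_set_pi (Set.finite_Icc _ _) (fun _ _ => isOpen_discrete _)
        refine Filter.mem_of_superset
          ((ho.preimage continuous_subtype_val).mem_nhds (fun i _ => rfl)) ?_
        intro w hw i hi
        exact (hw i (abs_le.mp hi)).symm
      · rw [hcyl w hw, hcyl w' (fun i hi => (hw i hi).trans (h i hi))]
  obtain ⟨M, hM⟩ := main
  exact ⟨M, fun z z' => hM z (Set.mem_univ z) z'⟩

lemma aut_shiftBy (e : ↥(XD n) ≃ₜ ↥(XD n)) (he : IsShiftAutomorphism (XD n) e) (k : ℤ) :
    ∀ z : ↥(XD n), (e ⟨shiftBy k z.1, shiftBy_mem_OC _ _ z.2 k⟩).1 = shiftBy k (e z).1 := by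
  induction k using Int.induction_on with
  | zero =>
    intro z
    have h : ∀ w : ℤ → Bool × ZMod n, shiftBy 0 w = w := fun w => by funext i; simp [shiftBy]
    simp only [h]
  | succ k ih =>
    intro z
    have h : ∀ w : ℤ → Bool × ZMod n, shiftBy (k + 1) w = shift (shiftBy k w) :=
      fun w => by funext i; simp only [shiftBy, shift]; congr 1; ring
    simp only [h]
    rw [he _ (shiftBy_mem_OC _ _ z.2 k), ih]
  | pred k ih =>
    intro z
    have h : ∀ w : ℤ → Bool × ZMod n, shift (shiftBy (-k - 1) w) = shiftBy (-k) w :=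
      fun w => by funext i; simp only [shiftBy, shift]; congr 1; ring
    have h1 := ih z
    have h2 := he (shiftBy (-k - 1) z.1) (shiftBy_mem_OC _ _ z.2 _)
      (shift_mem n _ (shiftBy_mem_OC _ _ z.2 _))
    simp only [h] at h2
    rw [h1] at h2
    funext i
    have h3 := congrFun h2 (i - 1)
    simp only [shift, sub_add_cancel] at h3
    rw [← h3]
    simp only [shiftBy]; congr 1; ring

/-- Every automorphism is one of the candidates. -/
lemma aut_eq_TT (e : ↥(XD n) ≃ₜ ↥(XD n)) (he : IsShiftAutomorphism (XD n) e) :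
    ∃ p : ℤ × ZMod n, ∀ z : ↥(XD n), (e z).1 = TT n p z.1 := by
  obtain ⟨M, hM⟩ := local_rule n e e.continuous
  -- the local rule at an arbitrary position
  have hloc : ∀ (z z' : ↥(XD n)) (i i' : ℤ),
      (∀ q : ℤ, |q| ≤ M → z.1 (q + i) = z'.1 (q + i')) → (e z).1 i = (e z').1 i' := by
    intro z z' i i' h
    have := hM ⟨shiftBy i z.1, shiftBy_mem_OC _ _ z.2 i⟩ ⟨shiftBy i' z'.1, shiftBy_mem_OC _ _ z'.2 i'⟩
      h
    rw [aut_shiftBy n e he, aut_shiftBy n e he] at this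
    simpa [shiftBy] using this
  set x0 : ↥(XD n) := ⟨deco n (tx n), deco_mem n⟩ with hx0
  have hy := fst_mem_OC n (e x0).1 (e x0).2
  -- level by level
  have hlev : ∀ K : ℕ, ∃ q : ℤ, |q| ≤ M ∧
      ∀ i, NH n K (i + q) → ((e x0).1 i).1 = tx n (i + q) := by
    intro K
    obtain ⟨r, hr, hoc⟩ := OC_struct n _ hy K
    have hq : ∃ q : ℤ, |q| ≤ M ∧ (lN n : ℤ) ^ K ∣ q - r := by
      by_contra hcon
      push Not at hcon
      apply OC_aper n _ hoc n (n_pos n).ne'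
      intro j
      apply congrArg Prod.fst
      apply hloc
      intro q hq
      show deco n (tx n) _ = deco n (tx n) _
      have hnh : NH n K (q + (lN n ^ K * j + hN n K - r)) := by
        rw [show q + ((lN n : ℤ) ^ K * j + hN n K - r) = (q - r + hN n K) + lN n ^ K * j by ring,
          NH_add]
        unfold NH
        rw [add_sub_cancel_right]
        exact hcon q hq
      rw [show q + ((lN n : ℤ) ^ K * (j + n) + hN n K - r) =
        q + (lN n ^ K * j + hN n K - r) + lN n ^ K * n by ring, deco, deco, tx_per n K _ _ hnh]
      simp
    obtain ⟨q, hqM, t, ht⟩ := hq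
    refine ⟨q, hqM, fun i hi => ?_⟩
    have e1 : i + q = i + r + lN n ^ K * t := by linarith
    rw [e1, NH_add] at hi
    rw [e1, tx_per n K _ _ hi]
    exact hr i hi
  have hq : ∃ q : ℤ, ∀ i, ((e x0).1 i).1 = tx n (i + q) := by
    by_contra hcon
    push Not at hcon
    choose f hf using hcon
    choose g hg using fun q : ℤ => exists_NH n |f q + q|
    obtain ⟨q, hqM, hq⟩ := hlev ((Finset.Icc (-M : ℤ) M).sup g)
    apply hf q
    apply hq
    apply hg q _ _ _ le_rfl
    exact Finset.le_sup (f := g) (Finset.mem_Icc.mpr (abs_le.mp hqM))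
  obtain ⟨q, hq⟩ := hq
  have hx : (e x0).1 = TT n (q, ((e x0).1 0).2 - q) (deco n (tx n)) := by
    funext i
    apply Prod.ext
    · exact hq i
    · rw [snd_of_mem_OC n _ (e x0).2 i]
      simp only [TT, deco]
      push_cast
      ring
  refine ⟨(q, ((e x0).1 0).2 - q), fun z => ?_⟩
  funext i
  obtain ⟨s, hs⟩ := z.2 (M + i.natAbs + q.natAbs)
  push_cast at hs
  have h1 : (e z).1 i = (e x0).1 (i + s) := by
    apply hloc
    intro r hr
    rw [hs _ (by have := abs_add_le r i; have := abs_nonneg q; omega)]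
    show deco n (tx n) _ = deco n (tx n) _
    congr 1; ring
  have h2 := congrFun hx (i + s)
  rw [h1, h2]
  simp only [TT]
  rw [hs (i + q) (by have := abs_add_le i q; omega)]
  rw [show i + q + s = i + s + q by ring]

lemma aut_group : AutGroupIsoZxZmod (XD n) n := by
  have hex : ∀ e : {e : ↥(XD n) ≃ₜ ↥(XD n) // IsShiftAutomorphism (XD n) e},
      ∃ p : ℤ × ZMod n, ∀ z : ↥(XD n), (e.1 z).1 = TT n p z.1 := fun e => aut_eq_TT n e.1 e.2
  choose Φ hΦ using hex
  refine ⟨Φ, ⟨?_, ?_⟩, ?_⟩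
  · intro e f hef
    apply Subtype.ext
    apply Homeomorph.ext
    intro z
    apply Subtype.ext
    rw [hΦ, hΦ, hef]
  · intro p
    refine ⟨⟨TH n p, TH_aut n p⟩, ?_⟩
    apply TT_inj n
    exact (hΦ ⟨TH n p, TH_aut n p⟩ ⟨deco n (tx n), deco_mem n⟩).symm
  · intro e f g h
    apply TT_inj n
    have h1 := congrArg Subtype.val (h ⟨deco n (tx n), deco_mem n⟩)
    rw [hΦ, hΦ, hΦ] at h1
    rw [TT_add]
    exact h1

end Aut



/-- For every `n ≥ 1` there is a constant-length, primitive, proper and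
recognizable directive sequence of alphabet rank at most `max 2 (n^n)` whose S-adic
subshift is an aperiodic Toeplitz subshift whose automorphism group is isomorphic to
`ℤ × ℤ/nℤ`. -/
theorem statement19 (n : ℕ) (hn : 1 ≤ n) :
    ∃ (B : ℕ → Type) (iB : ∀ k, Fintype (B k)) (τ : ∀ k, B (k+1) → List (B k)),
      NonErasing τ ∧ ConstantLength τ ∧ PrimitiveSeq τ ∧ ProperSeq τ ∧
      RecognizableSeq τ ∧ @AlphabetRankLE B iB (max 2 (n ^ n)) ∧
      (@IsToeplitzSubshift (B 0) ⊥ (XLevel τ 0)) ∧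
      (∀ x ∈ XLevel τ 0, IsAperiodicPoint x) ∧
      @AutGroupIsoZxZmod (B 0) ⊥ (XLevel τ 0) n := by

  haveI : NeZero n := ⟨by omega⟩
  refine ⟨BB n, iBB n, tau n, tau_nonErasing n, tau_constantLength n, tau_primitive n,
    tau_proper n, tau_recognizable n, tau_rank n, ?_, ?_, ?_⟩
  · rw [tau_XLevel]
    letI : TopologicalSpace (Bool × ZMod n) := ⊥
    haveI : DiscreteTopology (Bool × ZMod n) := ⟨rfl⟩
    exact ⟨deco n (tx n), deco_toeplitz n, OC_eq_closure (deco n (tx n))⟩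
  · rw [tau_XLevel]
    exact deco_aper n
  · rw [tau_XLevel]
    exact @aut_group n _ ⊥ (@DiscreteTopology.mk _ ⊥ rfl)

end ToeplitzFR
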